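/- Comparison for DPP solutions: let u, v : Ω_ε → ℝ be bounded Borel measurable functions satisfying the DPP in Ω with running payoffs f_u and f_v respectively, i.e. w(x) = (α/2)(sup_{B_ε(x)} w + inf_{B_ε(x)} w) + β ⨍_{B_ε(x)} w(y) dy + ε² f_w(x) for all x ∈ Ω, for (w, f_w) ∈ {(u, f_u), (v, f_v)}. If f_v ≥ f_u on Ω and v ≥ u on Γ_ε, then v ≥ u on all of Ω_ε. -/

import Mathlib

open MeasureTheory Metric Set Filter ProbabilityTheory

noncomputable section

/-- Euclidean space `ℝⁿ`. -/
abbrev En (n : ℕ) := EuclideanSpace ℝ (Fin n)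

/-- The boundary strip `Γ_ε = {x ∈ ℝⁿ \ Ω : dist(x, ∂Ω) ≤ ε}`. -/
def bdryStrip (n : ℕ) (Ω : Set (En n)) (ε : ℝ) : Set (En n) :=
  {x | x ∉ Ω ∧ Metric.infDist x (frontier Ω) ≤ ε}

/-- The dynamic programming principle (DPP) with running payoff `f`:
`u x = (α/2)(sup_{B_ε(x)} u + inf_{B_ε(x)} u) + β ⨍_{B_ε(x)} u + ε² f x` for all `x ∈ Ω`. -/
def SatisfiesDPP (n : ℕ) (α β ε : ℝ) (Ω : Set (En n)) (f u : En n → ℝ) : Prop :=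
  ∀ x ∈ Ω, u x =
    α / 2 * (sSup (u '' Metric.ball x ε) + sInf (u '' Metric.ball x ε))
      + β * (⨍ y in Metric.ball x ε, u y) + ε ^ 2 * f x

theorem ball_subset_union_bdryStrip {n : ℕ} {Ω : Set (En n)} {ε : ℝ} {x : En n} (hx : x ∈ Ω) :
    ball x ε ⊆ Ω ∪ bdryStrip n Ω ε := by
  intro y hy
  by_cases hyΩ : y ∈ Ω
  · exact Or.inl hyΩ
  have hne : Ωᶜ ≠ univ := fun h => (h ▸ mem_univ x : x ∈ Ωᶜ) hx
  obtain ⟨z, hz, hyz⟩ := exists_mem_frontier_infDist_compl_eq_dist (s := Ωᶜ) hyΩ hne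
  rw [frontier_compl] at hz
  rw [compl_compl] at hyz
  exact Or.inr ⟨hyΩ, (infDist_le_dist_of_mem hz).trans
    (hyz ▸ (infDist_le_dist_of_mem hx).trans (mem_ball.1 hy).le)⟩

theorem sSup_image_le_add_sSup_image {X : Type*} {s : Set X} (hs : s.Nonempty) {u v : X → ℝ}
    {M : ℝ} (hv : BddAbove (v '' s)) (h : ∀ x ∈ s, u x ≤ M + v x) :
    sSup (u '' s) ≤ M + sSup (v '' s) := by
  refine csSup_le (hs.image u) ?_
  rintro _ ⟨x, hx, rfl⟩
  linarith [h x hx, le_csSup hv (mem_image_of_mem v hx)]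

theorem sInf_image_le_add_sInf_image {X : Type*} {s : Set X} (hs : s.Nonempty) {u v : X → ℝ}
    {M : ℝ} (hu : BddBelow (u '' s)) (h : ∀ x ∈ s, u x ≤ M + v x) :
    sInf (u '' s) ≤ M + sInf (v '' s) := by
  have : sInf (u '' s) - M ≤ sInf (v '' s) := by
    refine le_csInf (hs.image v) ?_
    rintro _ ⟨x, hx, rfl⟩
    linarith [h x hx, csInf_le hu (mem_image_of_mem u hx)]
  linarith

theorem mul_le_setAverage {X : Type*} [MeasurableSpace X] {μ : Measure X} {s t : Set X}
    {g : X → ℝ} {c : ℝ} (hs : MeasurableSet s) (ht : MeasurableSet t) (hts : t ⊆ s)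
    (hμs : μ s ≠ ⊤) (hg : IntegrableOn g s μ) (hg0 : ∀ x ∈ s, 0 ≤ g x) (hgc : ∀ x ∈ t, c ≤ g x) :
    μ.real t / μ.real s * c ≤ ⨍ x in s, g x ∂μ := by
  have h1 : c * μ.real t ≤ ∫ x in t, g x ∂μ :=
    setIntegral_ge_of_const_le_real ht (measure_ne_top_of_subset hts hμs) hgc (hg.mono_set hts)
  have h2 : ∫ x in t, g x ∂μ ≤ ∫ x in s, g x ∂μ :=
    setIntegral_mono_set hg ((ae_restrict_iff' hs).2 (.of_forall hg0)) hts.eventuallyLE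
  rw [setAverage_eq, smul_eq_mul, div_mul_eq_mul_div, div_eq_inv_mul]
  gcongr
  linarith

theorem setAverage_sub {X : Type*} [MeasurableSpace X] {μ : Measure X} {s : Set X} {f g : X → ℝ}
    (hf : IntegrableOn f s μ) (hg : IntegrableOn g s μ) :
    ⨍ x in s, (f x - g x) ∂μ = (⨍ x in s, f x ∂μ) - ⨍ x in s, g x ∂μ := by
  simp only [setAverage_eq, smul_eq_mul]
  rw [integral_sub hf hg, mul_sub]

/-- Comparing the ball average at `x` with the values on a smaller ball shifted in a coordinate
direction propagates a positive lower bound from outside `Ω` across `Ω`. -/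
theorem exists_pos_le_of_mul_setAverage_le {n : ℕ} (i : Fin n) {Ω S : Set (En n)}
    (hΩ : Bornology.IsBounded Ω) {ε β m : ℝ} (hε : 0 < ε) (hβ : 0 < β) (hm : 0 < m)
    {g : En n → ℝ} (hball : ∀ x ∈ Ω, ball x ε ⊆ S) (hg0 : ∀ x ∈ S, 0 ≤ g x)
    (hout : ∀ x ∈ S, x ∉ Ω → m ≤ g x) (hint : ∀ x ∈ Ω, IntegrableOn g (ball x ε))
    (hg : ∀ x ∈ Ω, β * (⨍ y in ball x ε, g y) ≤ g x) :
    ∃ c, 0 < c ∧ ∀ x ∈ S, c ≤ g x := by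
  obtain ⟨R, hR⟩ := hΩ.exists_norm_le
  have hcoord (x y : En n) : |x i - y i| ≤ dist x y := by
    rw [dist_eq_norm]
    exact PiLp.norm_apply_le (x - y) i
  have hlayer (k : ℕ) : ∃ c, 0 < c ∧ ∀ x ∈ S, R - k * (ε / 2) < x i → c ≤ g x := by
    induction k with
    | zero =>
      refine ⟨m, hm, fun x hxS hx => hout x hxS fun hxΩ => ?_⟩
      have := (le_abs_self _).trans ((PiLp.norm_apply_le x i).trans (hR x hxΩ))
      simp only [Nat.cast_zero, zero_mul, sub_zero] at hx
      linarith
    | succ k ih =>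
      obtain ⟨c, hc, hcg⟩ := ih
      set κ : ℝ := volume.real (ball (0 : En n) (ε / 4)) / volume.real (ball (0 : En n) ε)
      have hvol {r : ℝ} (hr : 0 < r) : 0 < volume.real (ball (0 : En n) r) :=
        ENNReal.toReal_pos (measure_ball_pos _ _ hr).ne' measure_ball_lt_top.ne
      have hκ : 0 < κ := div_pos (hvol (by positivity)) (hvol hε)
      refine ⟨min m (β * (κ * c)), lt_min hm (by positivity), fun x hxS hx => ?_⟩
      by_cases hxΩ : x ∈ Ω
      swap
      · exact (min_le_left _ _).trans (hout x hxS hxΩ)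
      set x' : En n := x + EuclideanSpace.single i (3 * ε / 4)
      have hx'i : x' i = x i + 3 * ε / 4 := by simp [x']
      have hx'x : dist x' x = 3 * ε / 4 := by
        simp [x', dist_eq_norm, abs_of_pos hε]
      have hsub : ball x' (ε / 4) ⊆ ball x ε := ball_subset_ball' (by linarith)
      have havg := mul_le_setAverage measurableSet_ball measurableSet_ball hsub
        measure_ball_lt_top.ne (hint x hxΩ) (fun y hy => hg0 y (hball x hxΩ hy)) (c := c)
        fun y hy => hcg y (hball x hxΩ (hsub hy)) (by
          have := (abs_le.1 ((hcoord y x').trans (mem_ball.1 hy).le)).1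
          push_cast at hx
          linarith)
      rw [Measure.addHaar_real_ball_center, Measure.addHaar_real_ball_center volume x] at havg
      exact (min_le_right _ _).trans ((mul_le_mul_of_nonneg_left havg hβ.le).trans (hg x hxΩ))
  obtain ⟨k, hk⟩ := exists_nat_gt (2 * (R + 1) / (ε / 2))
  rw [div_lt_iff₀ (by positivity)] at hk
  obtain ⟨c, hc, hcg⟩ := hlayer k
  refine ⟨min m c, lt_min hm hc, fun x hxS => ?_⟩
  by_cases hxΩ : x ∈ Ω
  · refine (min_le_right _ _).trans (hcg x hxS ?_)
    have := (abs_le.1 ((PiLp.norm_apply_le x i).trans (hR x hxΩ))).1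
    linarith
  · exact (min_le_left _ _).trans (hout x hxS hxΩ)

/-- The difference of two solutions of the DPP is a subsolution when the payoffs are ordered. -/
theorem SatisfiesDPP.sub_le {n : ℕ} {α β ε M : ℝ} {Ω : Set (En n)} {fu fv u v : En n → ℝ}
    (hu : SatisfiesDPP n α β ε Ω fu u) (hv : SatisfiesDPP n α β ε Ω fv v) (hα : 0 ≤ α)
    (hε : 0 < ε) {x : En n} (hx : x ∈ Ω) (hf : fu x ≤ fv x)
    (huB : BddBelow (u '' ball x ε)) (hvB : BddAbove (v '' ball x ε))
    (hui : IntegrableOn u (ball x ε)) (hvi : IntegrableOn v (ball x ε))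
    (hM : ∀ y ∈ ball x ε, u y - v y ≤ M) :
    u x - v x ≤ α * M + β * ⨍ y in ball x ε, (u y - v y) := by
  have hne : (ball x ε).Nonempty := nonempty_ball.2 hε
  have hM' : ∀ y ∈ ball x ε, u y ≤ M + v y := fun y hy => by linarith [hM y hy]
  have hsup := sSup_image_le_add_sSup_image hne hvB hM'
  have hinf := sInf_image_le_add_sInf_image hne huB hM'
  have hfε := mul_le_mul_of_nonneg_left hf (sq_nonneg ε)
  have hα' := mul_le_mul_of_nonneg_left (add_le_add hsup hinf) (div_nonneg hα zero_le_two)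
  rw [setAverage_sub hui hvi, hu x hx, hv x hx]
  linarith


/-- Lemma 2.4. Comparison for DPP solutions: if `f_v ≥ f_u` on `Ω` and
`v ≥ u` on `Γ_ε`, then `v ≥ u` on `Ω_ε`. -/
theorem dpp_comparison
    (n : ℕ) (hn : 2 ≤ n) (Ω : Set (En n))
    (hΩopen : IsOpen Ω) (hΩbdd : Bornology.IsBounded Ω) (hΩconn : IsConnected Ω)
    (p : ℝ) (hp : 2 < p) (ε : ℝ) (hε : 0 < ε)
    (α β : ℝ) (hα : α = (p - 2) / (n + p)) (hβ : β = (n + 2) / (n + p))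
    (fu fv : En n → ℝ)
    (hfumeas : Measurable fu) (hfubdd : ∃ M, ∀ x ∈ Ω, |fu x| ≤ M)
    (hfupos : ∀ x ∈ Ω, 0 < fu x)
    (hfvmeas : Measurable fv) (hfvbdd : ∃ M, ∀ x ∈ Ω, |fv x| ≤ M)
    (hfvpos : ∀ x ∈ Ω, 0 < fv x)
    (u v : En n → ℝ)
    (humeas : Measurable u) (hubdd : ∃ M, ∀ x ∈ Ω ∪ bdryStrip n Ω ε, |u x| ≤ M)
    (hvmeas : Measurable v) (hvbdd : ∃ M, ∀ x ∈ Ω ∪ bdryStrip n Ω ε, |v x| ≤ M)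
    (hudpp : SatisfiesDPP n α β ε Ω fu u)
    (hvdpp : SatisfiesDPP n α β ε Ω fv v)
    (hf : ∀ x ∈ Ω, fu x ≤ fv x)
    (hbdry : ∀ x ∈ bdryStrip n Ω ε, u x ≤ v x) :
    ∀ x ∈ Ω ∪ bdryStrip n Ω ε, u x ≤ v x := by
  obtain ⟨Mu, hMu⟩ := hubdd
  obtain ⟨Mv, hMv⟩ := hvbdd
  set S := Ω ∪ bdryStrip n Ω ε
  have hn0 : (0 : ℝ) < n + p := by positivity
  have hα0 : 0 ≤ α := hα ▸ div_nonneg (by linarith) hn0.le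
  have hβ0 : 0 < β := hβ ▸ by positivity
  have hαβ : α + β = 1 := by
    rw [hα, hβ]
    field_simp
    ring
  have hball : ∀ x ∈ Ω, ball x ε ⊆ S := fun x hx => ball_subset_union_bdryStrip hx
  have hint {w : En n → ℝ} {C : ℝ} (hw : Measurable w) (hC : ∀ x ∈ S, |w x| ≤ C) (x : En n)
      (hx : x ∈ Ω) : IntegrableOn w (ball x ε) :=
    Measure.integrableOn_of_bounded measure_ball_lt_top.ne hw.aestronglyMeasurable
      ((ae_restrict_iff' measurableSet_ball).2 (.of_forall fun y hy => hC y (hball x hx hy)))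
  have hui := hint humeas hMu
  have hvi := hint hvmeas hMv
  have hbdd : BddAbove ((fun x => u x - v x) '' S) := by
    refine ⟨Mu + Mv, ?_⟩
    rintro _ ⟨x, hx, rfl⟩
    have := abs_le.1 (hMu x hx)
    have := abs_le.1 (hMv x hx)
    dsimp only
    linarith
  set M := sSup ((fun x => u x - v x) '' S)
  have hM : ∀ x ∈ S, u x - v x ≤ M := fun x hx => le_csSup hbdd (mem_image_of_mem _ hx)
  intro x hx
  rcases le_or_gt M 0 with hM0 | hM0
  · linarith [hM x hx]
  obtain ⟨c, hc, hcg⟩ := exists_pos_le_of_mul_setAverage_le (⟨0, by lia⟩ : Fin n) hΩbdd hε hβ0 hM0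
    (g := fun y => M - (u y - v y)) hball (fun y hy => sub_nonneg.2 (hM y hy))
    (fun y hy hyΩ => by linarith [hbdry y (hy.resolve_left hyΩ)])
    (fun y hy => (integrableOn_const measure_ball_lt_top.ne).sub ((hui y hy).sub (hvi y hy)))
    (fun y hy => by
      have hsub := hudpp.sub_le hvdpp hα0 hε hy (hf y hy)
        ⟨-Mu, forall_mem_image.2 fun z hz => (abs_le.1 (hMu z (hball y hy hz))).1⟩
        ⟨Mv, forall_mem_image.2 fun z hz => (abs_le.1 (hMv z (hball y hy hz))).2⟩
        (hui y hy) (hvi y hy) fun z hz => hM z (hball y hy hz)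
      rw [setAverage_sub (g := fun z => u z - v z) (integrableOn_const measure_ball_lt_top.ne)
          ((hui y hy).sub (hvi y hy)),
        setAverage_const (measure_ball_pos _ _ hε).ne' measure_ball_lt_top.ne]
      have : α * M + β * M = M := by rw [← add_mul, hαβ, one_mul]
      linarith)
  have : M ≤ M - c := by
    refine csSup_le (Set.Nonempty.image _ ⟨x, hx⟩) (forall_mem_image.2 fun y hy => ?_)
    linarith [hcg y hy]
  linarith
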